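/- Let (m_0, m_1, ..., m_ℓ) be nonnegative integers summing to n, with m_0 allowed to be placed only in the first row. Then in the ring of symmetric functions, s_{(m_0)} · Π_{r=1}^{ℓ} Σ_{i=0}^{m_r} s_{(i)} s_{(m_r − i)} = Σ_{λ ⊢ n} |T^λ_{(m_0,...,m_ℓ)}| s_λ, where |T^λ_{(m_0,...,m_ℓ)}| is the number of symplectic tableaux of shape λ/(m_0) and weight (m_0, m_1, ..., m_ℓ). -/

import Mathlib

/-!
Common framework for a formalization of statements from
"Gelfand–Graev characters of the finite unitary groups" (Thiem–Vinroot).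
-/

open scoped Classical

noncomputable section

namespace GGU

/-! ### Partitions -/

/-- A partition, encoded as a weakly decreasing, finitely supported sequence of
natural numbers; `parts i` is the `i`-th part `λ_i` for `i ≥ 1`, and `parts 0 = 0`
by convention. -/
structure Partn where
  parts : ℕ → ℕ
  parts_zero : parts 0 = 0
  parts_antitone : ∀ ⦃i j : ℕ⦄, 1 ≤ i → i ≤ j → parts j ≤ parts i
  parts_finite : {i : ℕ | parts i ≠ 0}.Finite

/-- The size `|λ|` of a partition. -/
def Partn.size (l : Partn) : ℕ := ∑ᶠ i, l.parts i

/-- The length `ℓ(λ)` (number of nonzero parts) of a partition. -/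
def Partn.len (l : Partn) : ℕ := {i : ℕ | l.parts i ≠ 0}.ncard

/-- The statistic `n(λ) = ∑ (i-1)·λ_i`. -/
def Partn.nstat (l : Partn) : ℕ := ∑ᶠ i, (i - 1) * l.parts i

/-- The multiplicity `m_k(λ)` of the part `k ≥ 1` in `λ`. -/
def Partn.mult (l : Partn) (k : ℕ) : ℕ := {i : ℕ | 1 ≤ i ∧ l.parts i = k}.ncard

/-- `z_λ = ∏_k k^{m_k} m_k!`. -/
def Partn.zee (l : Partn) : ℕ := ∏ᶠ k, k ^ l.mult k * (l.mult k).factorial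

/-- The cell `(i,j)` (row `i ≥ 1`, column `j ≥ 1`) lies in the Young diagram of `λ`. -/
def Partn.cell (l : Partn) (c : ℕ × ℕ) : Prop := 1 ≤ c.1 ∧ 1 ≤ c.2 ∧ c.2 ≤ l.parts c.1

/-- The empty partition. -/
def Partn.empty : Partn where
  parts := fun _ => 0
  parts_zero := rfl
  parts_antitone := fun _ _ _ _ => le_rfl
  parts_finite := by simp

/-- The one-row partition `(m)`. -/
def Partn.ofRow (m : ℕ) : Partn where
  parts := fun i => if i = 1 then m else 0
  parts_zero := by simp
  parts_antitone := by
    intro i j hi hij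
    by_cases hj : j = 1
    · have hi1 : i = 1 := by omega
      simp [hj, hi1]
    · simp [hj]
  parts_finite := Set.Finite.subset (Set.finite_singleton 1) (by
    intro i hi
    by_cases h : i = 1 <;> simp_all)

/-- Partial sums `λ_1 + ⋯ + λ_k`. -/
def Partn.cumul (l : Partn) (k : ℕ) : ℕ := ∑ t ∈ Finset.range k, l.parts (t + 1)

/-- Strict dominance order on partitions of the same size. -/
def DomLt (l m : Partn) : Prop :=
  l.size = m.size ∧ l ≠ m ∧ ∀ k, l.cumul k ≤ m.cumul k

/-- The set `{ν_{≤ 1}, ν_{≤ 2}, …}` of partial sums of a partition `ν`. -/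
def cumSet (nu : Partn) : Set ℕ := {m : ℕ | ∃ j, 1 ≤ j ∧ m = nu.cumul j}

/-- Lexicographic order on weight sequences. -/
def LexLE (f g : ℕ → ℕ) : Prop := f = g ∨ ∃ k, f k < g k ∧ ∀ j < k, f j = g j

/-! ### Dominoes, 2-cores and 2-quotients -/

/-- Two cells are adjacent (horizontally or vertically). -/
def adjCell (c d : ℕ × ℕ) : Prop :=
  (c.1 = d.1 ∧ (c.2 + 1 = d.2 ∨ d.2 + 1 = c.2)) ∨
  (c.2 = d.2 ∧ (c.1 + 1 = d.1 ∨ d.1 + 1 = c.1))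

/-- `DomStep μ ρ` : the partition `ρ` is obtained from `μ` by removing one domino. -/
def DomStep (mu rho : Partn) : Prop :=
  (∀ i, rho.parts i ≤ mu.parts i) ∧
  ∃ c d : ℕ × ℕ, c ≠ d ∧ adjCell c d ∧
    mu.cell c ∧ mu.cell d ∧ ¬ rho.cell c ∧ ¬ rho.cell d ∧
    ∀ e : ℕ × ℕ, mu.cell e → ¬ rho.cell e → e = c ∨ e = d

/-- `γ` is the 2-core of `λ`: it is obtained from `λ` by successively removing
dominoes, and admits no further domino removal. -/
def TwoCore (lam gam : Partn) : Prop :=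
  Relation.ReflTransGen DomStep lam gam ∧ ∀ rho, ¬ DomStep gam rho

/-- `core₂(λ) ∈ {∅, (1)}`. -/
def core2small (lam : Partn) : Prop := ∃ gam, TwoCore lam gam ∧ gam.size ≤ 1

/-- The size `|core₂(λ)|` of the 2-core of `λ`. -/
def core2size (lam : Partn) : ℕ := sInf {s | ∃ gam, TwoCore lam gam ∧ gam.size = s}

/-- The `j`-th part of one member (`ε ∈ {0,1}`) of the 2-quotient of `λ`,
computed from the β-set `{λ_t + N - t : 1 ≤ t ≤ N}` with `N = 2(|λ|+1)`. -/
def quot2part (lam : Partn) (ε : ℕ) (j : ℕ) : ℕ :=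
  let N := 2 * (lam.size + 1)
  let B := (Finset.range N).image fun t => lam.parts (t + 1) + (N - (t + 1))
  let L := (B.filter fun b => b % 2 = ε).sort (· ≤ ·)
  if 1 ≤ j ∧ j ≤ L.length then (L.getD (L.length - j) 0) / 2 - (L.length - j) else 0

/-- `quot₂(λ)_j`, the sum of the `j`-th parts of the two members of the 2-quotient. -/
def quot2sum (lam : Partn) (j : ℕ) : ℕ := quot2part lam 0 j + quot2part lam 1 j

/-! ### Tableaux -/

/-- A semistandard (column-strict) Young tableau of shape `λ` with entries in `{1,2,…}`. -/
structure SSYT (lam : Partn) where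
  entry : ℕ × ℕ → ℕ
  entry_pos : ∀ c, lam.cell c → 1 ≤ entry c
  entry_outside : ∀ c, ¬ lam.cell c → entry c = 0
  row_weak : ∀ i j : ℕ, lam.cell (i, j + 1) → entry (i, j) ≤ entry (i, j + 1)
  col_strict : ∀ i j : ℕ, 1 ≤ i → lam.cell (i + 1, j) → entry (i, j) < entry (i + 1, j)

/-- The number of entries equal to `k` in a semistandard tableau. -/
def SSYT.wt {lam : Partn} (T : SSYT lam) (k : ℕ) : ℕ :=
  {c : ℕ × ℕ | lam.cell c ∧ T.entry c = k}.ncard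

/-- A symplectic tableau: a column strict filling of `λ` by the symbols
`0 < 1̄ < 1 < 2̄ < 2 < ⋯`, where the symbol `0` is encoded by `0`, `k̄` by `2k-1`
and `k` by `2k`. -/
structure SympTab (lam : Partn) where
  entry : ℕ × ℕ → ℕ
  entry_outside : ∀ c, ¬ lam.cell c → entry c = 0
  row_weak : ∀ i j : ℕ, lam.cell (i, j + 1) → entry (i, j) ≤ entry (i, j + 1)
  col_strict : ∀ i j : ℕ, 1 ≤ i → lam.cell (i + 1, j) → entry (i, j) < entry (i + 1, j)

/-- The weight of a symplectic tableau: `wt 0` is the number of `0`'s, and for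
`k ≥ 1`, `wt k` is the number of `k̄`'s plus the number of `k`'s. -/
def SympTab.wt {lam : Partn} (T : SympTab lam) (k : ℕ) : ℕ :=
  if k = 0 then {c : ℕ × ℕ | lam.cell c ∧ T.entry c = 0}.ncard
  else {c : ℕ × ℕ | lam.cell c ∧ (T.entry c = 2 * k - 1 ∨ T.entry c = 2 * k)}.ncard

/-- The cells of `λ/(m₀)`: cells of `λ` other than the `m₀` leftmost cells of the
first row. -/
def Partn.tiled (lam : Partn) (m0 : ℕ) (c : ℕ × ℕ) : Prop :=
  lam.cell c ∧ ¬ (c.1 = 1 ∧ c.2 ≤ m0)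

/-- A (semistandard) domino tableau of shape `λ/(m₀)`: a column strict filling of a
tiling of `λ/(m₀)` by dominoes, with `0`'s in the `m₀` non-tiled boxes.  The tiling is
recorded by the involution `mate` matching each tiled cell with the other cell of its
domino. -/
structure DomTab (lam : Partn) (m0 : ℕ) where
  m0_le : m0 ≤ lam.parts 1
  entry : ℕ × ℕ → ℕ
  mate : ℕ × ℕ → ℕ × ℕ
  entry_pos : ∀ c, lam.tiled m0 c → 1 ≤ entry c
  entry_zero : ∀ c, ¬ lam.tiled m0 c → entry c = 0
  mate_tiled : ∀ c, lam.tiled m0 c → lam.tiled m0 (mate c)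
  mate_id : ∀ c, ¬ lam.tiled m0 c → mate c = c
  mate_invol : ∀ c, mate (mate c) = c
  mate_adj : ∀ c, lam.tiled m0 c → adjCell c (mate c)
  mate_entry : ∀ c, entry (mate c) = entry c
  row_weak : ∀ i j : ℕ, lam.cell (i, j + 1) → entry (i, j) ≤ entry (i, j + 1)
  col_strict : ∀ i j : ℕ, 1 ≤ i → lam.cell (i + 1, j) → mate (i, j) ≠ (i + 1, j) →
    entry (i, j) < entry (i + 1, j)

/-- The weight of a domino tableau: `wt k` is the number of dominoes labelled `k`. -/
def DomTab.wt {lam : Partn} {m0 : ℕ} (T : DomTab lam m0) (k : ℕ) : ℕ :=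
  {c : ℕ × ℕ | lam.tiled m0 c ∧ T.entry c = k}.ncard / 2

/-! ### Θ-partitions and battery tableaux -/

/-- A `Θ`-partition: an assignment of a partition to each element of the index
type `Th` (the set of Frobenius orbits), with finite support. -/
structure TPartn (Th : Type) where
  lam : Th → Partn
  finite : {φ : Th | lam φ ≠ Partn.empty}.Finite

/-- The size `|λ| = ∑_φ |φ|·|λ^{(φ)}|` of a `Θ`-partition, where `deg φ` is the
orbit size `|φ|`. -/
def TPartn.size {Th : Type} (deg : Th → ℕ) (l : TPartn Th) : ℕ :=
  ∑ᶠ φ, deg φ * (l.lam φ).size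

/-- `n(λ) = ∑_φ |φ|·n(λ^{(φ)})` for a `Θ`-partition. -/
def TPartn.nstat {Th : Type} (deg : Th → ℕ) (l : TPartn Th) : ℕ :=
  ∑ᶠ φ, deg φ * (l.lam φ).nstat

/-- A battery `Θ`-tableau of shape `λ/γ` (with `hgt(γ) ≤ 1`, so that `γ^{(φ)}` is the
one-row partition `(γ^{(φ)}_1)`): a domino tableau of shape `λ^{(φ)}/(γ^{(φ)}_1)` for each
`φ` with `|φ|` odd, and a symplectic tableau of shape `λ^{(φ)}/(γ^{(φ)}_1)` for each `φ`
with `|φ|` even. -/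
structure BatteryTab {Th : Type} (deg : Th → ℕ) (lam gam : Th → Partn) where
  dom : ∀ φ, Odd (deg φ) → DomTab (lam φ) ((gam φ).parts 1)
  symp : ∀ φ, ¬ Odd (deg φ) → SympTab (lam φ)
  symp_wt0 : ∀ φ (h : ¬ Odd (deg φ)), (symp φ h).wt 0 = (gam φ).parts 1

/-- The weight of a battery tableau:
`wt(Q)_i = ∑_{|φ| odd} |φ|·wt(Q^{(φ)})_i + ∑_{|φ| even} (|φ|/2)·wt(Q^{(φ)})_i`. -/
def BatteryTab.wt {Th : Type} {deg : Th → ℕ} {lam gam : Th → Partn}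
    (T : BatteryTab deg lam gam) (i : ℕ) : ℕ :=
  ∑ᶠ φ : Th, if h : Odd (deg φ) then deg φ * (T.dom φ h).wt i
    else (deg φ / 2) * (T.symp φ h).wt i

/-- The set `B^λ_{(k,ν)}` of battery tableaux of shape `λ/γ`, for some `Θ`-partition
`γ` of size `k` with `hgt(γ) ≤ 1`, and of weight `ν`. -/
structure Battery {Th : Type} (deg : Th → ℕ) (lam : TPartn Th) (k : ℕ) (nu : Partn) where
  gam : TPartn Th
  gam_size : TPartn.size deg gam = k
  gam_hgt : ∀ φ, (gam.lam φ).len ≤ 1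
  gam_le : ∀ φ, (gam.lam φ).parts 1 ≤ (lam.lam φ).parts 1
  tab : BatteryTab deg lam.lam gam.lam
  tab_wt : ∀ i, 1 ≤ i → tab.wt i = nu.parts i

/-! ### Symmetric functions as formal power series -/

/-- The Schur function `s_λ` in the variables `X_0, X_1, X_2, …`, defined
combinatorially: the coefficient of a monomial is the number of semistandard Young
tableaux of shape `λ` with the corresponding content. -/
def sSchur (lam : Partn) : MvPowerSeries ℕ ℂ :=
  fun d => (Nat.card {T : SSYT lam // ∀ k, 1 ≤ k → T.wt k = d (k - 1)} : ℂ)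

/-- The Schur function `s_λ(Y^{(φ)})` in the variable family `Y^{(φ)}`, inside the ring
of symmetric functions in the variables `{Y^{(φ)}_j : φ ∈ Θ, j ∈ ℕ}`. -/
def sSchurAt {Th : Type} (φ : Th) (lam : Partn) : MvPowerSeries (Th × ℕ) ℂ :=
  fun d => if ∀ x ∈ d.support, x.1 = φ then
    (Nat.card {T : SSYT lam // ∀ k, 1 ≤ k → T.wt k = d (φ, k - 1)} : ℂ) else 0

/-- `s_λ = ∏_φ s_{λ^{(φ)}}(Y^{(φ)})` for a `Θ`-partition `λ`. -/
def sTheta {Th : Type} (l : TPartn Th) : MvPowerSeries (Th × ℕ) ℂ :=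
  ∏ᶠ φ, sSchurAt φ (l.lam φ)

/-- The monomial symmetric function `m_λ`. -/
def msym (l : Partn) : MvPowerSeries ℕ ℂ :=
  fun d => if d.support.val.map (fun i => d i) = l.parts_finite.toFinset.val.map l.parts
    then 1 else 0

/-- The power sum `p_k = ∑_i X_i^k` (with `p_0 = 1` by convention). -/
def ppow (k : ℕ) : MvPowerSeries ℕ ℂ :=
  if k = 0 then 1
  else fun d => if ∃ i : ℕ, d = Finsupp.single i k then 1 else 0

/-- The power sum symmetric function `p_ν = p_{ν_1} p_{ν_2} ⋯`. -/
def psym (l : Partn) : MvPowerSeries ℕ ℂ := ∏ᶠ i, ppow (l.parts i)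

/-- Plethysm with the power sum `p_2`: `(f ∘ p_2)(X_0, X_1, …) = f(X_0^2, X_1^2, …)`. -/
def plet2 (F : MvPowerSeries ℕ ℂ) : MvPowerSeries ℕ ℂ :=
  fun d => if ∀ i, 2 ∣ d i
    then F (Finsupp.mapRange (· / 2) (Nat.zero_div 2) d) else 0



/-! ### The finite groups: `GL(n, F_{p^r})` and `U(n, F_{q²})` inside `GL(n, F̄_p)` -/

/-- An algebraic closure `F̄_p` of the prime field. -/
abbrev Fbar (p : ℕ) [Fact p.Prime] : Type := AlgebraicClosure (ZMod p)

/-- The field endomorphism `x ↦ x^{p^r}` of `F̄_p`. -/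
def frobPow (p : ℕ) [Fact p.Prime] (r : ℕ) : Fbar p →+* Fbar p :=
  haveI : CharP (Fbar p) p :=
    charP_of_injective_algebraMap (algebraMap (ZMod p) (Fbar p)).injective p
  haveI : ExpChar (Fbar p) p := ExpChar.prime Fact.out
  iterateFrobenius (Fbar p) p r

/-- The entrywise Frobenius `(a_{ij}) ↦ (a_{ij}^{p^r})` on `GL(n, F̄_p)`. -/
def entryFrobGL (p : ℕ) [Fact p.Prime] (r n : ℕ) :
    (Matrix (Fin n) (Fin n) (Fbar p))ˣ →* (Matrix (Fin n) (Fin n) (Fbar p))ˣ :=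
  Units.map ((frobPow p r).mapMatrix.toMonoidHom)

/-- `GL(n, F_{p^r})`, realized as the fixed points of the entrywise Frobenius
`(a_{ij}) ↦ (a_{ij}^{p^r})` on `GL(n, F̄_p)`. -/
def GLfix (p : ℕ) [Fact p.Prime] (r n : ℕ) : Subgroup (Matrix (Fin n) (Fin n) (Fbar p))ˣ where
  carrier := {A | entryFrobGL p r n A = A}
  one_mem' := by simp
  mul_mem' := by
    intro a b ha hb
    simp only [Set.mem_setOf_eq, map_mul] at *
    rw [ha, hb]
  inv_mem' := by
    intro a ha
    simp only [Set.mem_setOf_eq, map_inv] at *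
    rw [ha]

/-- The anti-transpose `(M^{at})_{ij} = M_{n+1-j, n+1-i}` of a matrix. -/
def atrans {n : ℕ} {K : Type*} (M : Matrix (Fin n) (Fin n) K) : Matrix (Fin n) (Fin n) K :=
  Matrix.of fun i j => M (Fin.rev j) (Fin.rev i)

lemma atrans_one {n : ℕ} {K : Type*} [NonAssocSemiring K] :
    atrans (1 : Matrix (Fin n) (Fin n) K) = 1 := by
  ext i j
  simp only [atrans, Matrix.of_apply, Matrix.one_apply, Fin.rev_inj]
  by_cases h : i = j
  · simp [h]
  · simp [h, Ne.symm h]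

lemma atrans_mul {n : ℕ} {K : Type*} [CommSemiring K] (M N : Matrix (Fin n) (Fin n) K) :
    atrans (M * N) = atrans N * atrans M := by
  ext i j
  simp only [atrans, Matrix.of_apply, Matrix.mul_apply]
  exact Fintype.sum_equiv Fin.revPerm _ _ (fun k => by
    simp [Fin.rev_rev, mul_comm])

/-- The twisted Frobenius `F'(A) = (ᵃ(A^{p^f}))⁻¹` (entrywise `q = p^f` power, followed by
anti-transpose-inverse) on `GL(n, F̄_p)`, whose fixed point group is the finite unitary
group `U(n, F_{q²})`. -/
def unitaryFrob (p : ℕ) [Fact p.Prime] (fexp n : ℕ) :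
    (Matrix (Fin n) (Fin n) (Fbar p))ˣ →* (Matrix (Fin n) (Fin n) (Fbar p))ˣ where
  toFun A :=
    { val := atrans ((frobPow p fexp).mapMatrix A.inv)
      inv := atrans ((frobPow p fexp).mapMatrix A.val)
      val_inv := by
        rw [← atrans_mul, ← map_mul, A.val_inv, map_one, atrans_one]
      inv_val := by
        rw [← atrans_mul, ← map_mul, A.inv_val, map_one, atrans_one] }
  map_one' := by
    apply Units.ext
    show atrans ((frobPow p fexp).mapMatrix (1 : Matrix (Fin n) (Fin n) (Fbar p))) = _
    rw [map_one, atrans_one]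
    rfl
  map_mul' := by
    intro A B
    apply Units.ext
    show atrans ((frobPow p fexp).mapMatrix (B.inv * A.inv)) = _
    rw [map_mul, atrans_mul]
    rfl

/-- The finite unitary group `U(n, F_{q²})` (with `q = p^fexp`), realized as the fixed
points of the twisted Frobenius `F'` on `GL(n, F̄_p)`. -/
def Uprime (p : ℕ) [Fact p.Prime] (fexp n : ℕ) :
    Subgroup (Matrix (Fin n) (Fin n) (Fbar p))ˣ where
  carrier := {A | unitaryFrob p fexp n A = A}
  one_mem' := by simp
  mul_mem' := by
    intro a b ha hb
    simp only [Set.mem_setOf_eq, map_mul] at *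
    rw [ha, hb]
  inv_mem' := by
    intro a ha
    simp only [Set.mem_setOf_eq, map_inv] at *
    rw [ha]

/-- The underlying matrix of an element of a subgroup of `GL(n, F̄_p)`. -/
def matOf {p : ℕ} [Fact p.Prime] {n : ℕ} {H : Subgroup (Matrix (Fin n) (Fin n) (Fbar p))ˣ}
    (u : ↥H) : Matrix (Fin n) (Fin n) (Fbar p) :=
  ((u : (Matrix (Fin n) (Fin n) (Fbar p))ˣ) : Matrix (Fin n) (Fin n) (Fbar p))

/-- The subgroup (as a subset) of unipotent upper-triangular matrices in `H`. -/
def unitri {p : ℕ} [Fact p.Prime] {n : ℕ} (H : Subgroup (Matrix (Fin n) (Fin n) (Fbar p))ˣ) :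
    Set ↥H :=
  {u | (∀ i j : Fin n, j < i → matOf u i j = 0) ∧ ∀ i : Fin n, matOf u i i = 1}

/-! ### Class function machinery -/

/-- The induced class function `Ind_B^G ψ (g) = |B|⁻¹ ∑_{x ∈ G, x⁻¹gx ∈ B} ψ(x⁻¹gx)`,
for a subset `B` of `G` and `ψ : G → ℂ` (only the values of `ψ` on `B` matter). -/
def indChar {G : Type} [Group G] (B : Set G) (ψ : G → ℂ) : G → ℂ :=
  fun g => (Nat.card B : ℂ)⁻¹ * ∑ᶠ x : G, if x⁻¹ * g * x ∈ B then ψ (x⁻¹ * g * x) else 0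

/-- The inner product `⟨f, h⟩ = |G|⁻¹ ∑_g f(g) \overline{h(g)}` of complex class
functions on a finite group. -/
def charInner {G : Type} (f h : G → ℂ) : ℂ :=
  (Nat.card G : ℂ)⁻¹ * ∑ᶠ g : G, f g * (starRingEnd ℂ) (h g)

/-- `θ : G → ℂ` is the character of an irreducible (complex) representation of `G`. -/
def IsIrredChar (G : Type) [Group G] (θ : G → ℂ) : Prop :=
  ∃ V : FDRep ℂ G, CategoryTheory.Simple V ∧ θ = fun g => V.character g

/-- `M` is a unipotent matrix whose Jordan type is the partition `μ`, expressed through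
the ranks of the powers of `M - 1`:  `rank((M-1)^k) = ∑_i max(μ_i - k, 0)` for all `k`. -/
def unipOfType {n : ℕ} {K : Type*} [Field K] (M : Matrix (Fin n) (Fin n) K)
    (mu : Partn) : Prop :=
  ∀ k : ℕ, ((M - 1) ^ k).rank = ∑ᶠ i, (mu.parts i - k)

/-! ### Gelfand–Graev and degenerate Gelfand–Graev characters -/

/-- The sum of the superdiagonal entries `u_{i,i+1}`, `1 ≤ i ≤ ⌊n/2⌋`, `i ∉ S`,
of an element of the unitary group (in the `F'`-fixed, upper-triangular realization). -/
def sdSumU (p : ℕ) [Fact p.Prime] (fexp n : ℕ) (S : Set ℕ)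
    (u : ↥(Uprime p fexp n)) : Fbar p :=
  ∑ i : Fin n, ∑ j : Fin n,
    if (j : ℕ) = (i : ℕ) + 1 ∧ (j : ℕ) ≤ n / 2 ∧ (j : ℕ) ∉ S then matOf u i j else 0

/-- The degenerate Gelfand–Graev character `Γ_{(k,ν)}` of `U(n, F_{q²})` (it depends only
on `ν`; `k = n - 2|ν|`).  It is induced from the linear character
`u ↦ ψ₀(∑_{i ≤ ⌊n/2⌋, i ∉ ν_≤} u_{i,i+1})` of the unipotent upper-triangular subgroup,
where `ν_≤` is the set of partial sums of `ν`.  Taking `ν = ∅` gives the Gelfand–Graev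
character `Γ_{(n)}`. -/
def GammaDGG (p : ℕ) [Fact p.Prime] (fexp n : ℕ) (ψ0 : Fbar p → ℂ) (nu : Partn) :
    ↥(Uprime p fexp n) → ℂ :=
  indChar (unitri (Uprime p fexp n)) (fun u => ψ0 (sdSumU p fexp n (cumSet nu) u))

/-- The sum of all superdiagonal entries of an element of `GL(n, F_{p^r})`. -/
def sdSumGL (p : ℕ) [Fact p.Prime] (r n : ℕ) (u : ↥(GLfix p r n)) : Fbar p :=
  ∑ i : Fin n, ∑ j : Fin n, if (j : ℕ) = (i : ℕ) + 1 then matOf u i j else 0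

/-- The Gelfand–Graev character of `GL(n, F_{p^r})`, induced from the generic linear
character `u ↦ ψ₀(u_{1,2} + u_{2,3} + ⋯ + u_{n-1,n})` of the unipotent upper-triangular
subgroup. -/
def GammaGL (p : ℕ) [Fact p.Prime] (r n : ℕ) (ψ0 : Fbar p → ℂ) : ↥(GLfix p r n) → ℂ :=
  indChar (unitri (GLfix p r n)) (fun u => ψ0 (sdSumGL p r n u))

/-! ### Harish-Chandra induction from `GL(n, F_{q²})` to `U(2n, F_{q²})` -/

/-- The (maximally split) parabolic subgroup of `U(2n, F_{q²})` with Levi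
`GL(n, F_{q²})`: block upper-triangular matrices. -/
def PsetGLU (p : ℕ) [Fact p.Prime] (fexp n : ℕ) : Set ↥(Uprime p fexp (2 * n)) :=
  {g | ∀ i j : Fin (2 * n), (j : ℕ) < n → n ≤ (i : ℕ) → matOf g i j = 0}

/-- Harish-Chandra induction `R_{GL(n,F_{q²})}^{U(2n,F_{q²})}` of a class function `θ` of
`GL(n, F_{q²})`: inflate `θ` to the parabolic `P` through the Levi projection (upper-left
`n × n` block) and induce to `U(2n, F_{q²})`. -/
def HCIndGLtoU (p : ℕ) [Fact p.Prime] (fexp n : ℕ)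
    (θ : ↥(GLfix p (2 * fexp) n) → ℂ) : ↥(Uprime p fexp (2 * n)) → ℂ :=
  fun g =>
    (Nat.card (PsetGLU p fexp n) : ℂ)⁻¹ *
      ∑ᶠ x : ↥(Uprime p fexp (2 * n)), ∑ᶠ l : ↥(GLfix p (2 * fexp) n),
        if x⁻¹ * g * x ∈ PsetGLU p fexp n ∧
            (∀ i j : Fin n,
              matOf (x⁻¹ * g * x) (Fin.castLE (by omega) i) (Fin.castLE (by omega) j) =
                matOf l i j)
        then θ l else 0

/-! ### Proof -/

lemma Partn.ext' {l m : Partn} (h : ∀ i, l.parts (i + 1) = m.parts (i + 1)) : l = m := by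
  cases l with
  | mk p hp0 h1 h2 =>
  cases m with
  | mk q hq0 h3 h4 =>
  have : p = q := by
    funext i
    cases i with
    | zero => rw [hp0, hq0]
    | succ i => exact h i
  subst this
  rfl

lemma Partn.anti (l : Partn) (i : ℕ) : l.parts (i + 2) ≤ l.parts (i + 1) :=
  l.parts_antitone (by omega) (by omega)

lemma Partn.exists_bd (l : Partn) : ∃ M, ∀ i, M ≤ i → l.parts (i + 1) = 0 := by
  obtain ⟨M, hM⟩ := l.parts_finite.bddAbove
  refine ⟨M, fun i hi => ?_⟩
  by_contra h
  have : i + 1 ≤ M := hM h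
  omega

lemma Partn.size_eq (l : Partn) (M : ℕ) (hM : ∀ i, M ≤ i → l.parts (i + 1) = 0) :
    l.size = ∑ i ∈ Finset.range M, l.parts (i + 1) := by
  unfold Partn.size
  rw [finsum_eq_sum_of_support_subset (s := Finset.range (M + 1))]
  · rw [Finset.sum_range_succ', l.parts_zero, add_zero]
  · intro i hi
    simp only [Function.mem_support] at hi
    simp only [Finset.coe_range, Set.mem_Iio]
    by_contra h
    apply hi
    obtain ⟨j, rfl⟩ : ∃ j, i = j + 1 := ⟨i - 1, by omega⟩
    exact hM j (by omega)

lemma Partn.part_le_size (l : Partn) (i : ℕ) : l.parts (i + 1) ≤ l.size := by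
  obtain ⟨M, hM⟩ := l.exists_bd
  by_cases h : M ≤ i
  · rw [hM i h]; exact Nat.zero_le _
  · rw [l.size_eq M hM]
    exact Finset.single_le_sum (f := fun i => l.parts (i + 1)) (fun _ _ => Nat.zero_le _)
      (Finset.mem_range.2 (by omega))

lemma Partn.zero_of_size (l : Partn) (n : ℕ) (hl : l.size ≤ n) (i : ℕ) (hi : n ≤ i) :
    l.parts (i + 1) = 0 := by
  by_contra h
  obtain ⟨M, hM⟩ := l.exists_bd
  have hiM : i < M := by
    by_contra h'
    exact h (hM i (by omega))
  rw [l.size_eq M hM] at hl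
  have h1 : ∑ j ∈ Finset.range (i + 1), l.parts (j + 1) ≤
      ∑ j ∈ Finset.range M, l.parts (j + 1) :=
    Finset.sum_le_sum_of_subset (Finset.range_subset_range.2 (by omega))
  have h2 : ∑ j ∈ Finset.range (i + 1), 1 ≤ ∑ j ∈ Finset.range (i + 1), l.parts (j + 1) := by
    apply Finset.sum_le_sum
    intro j hj
    have := Finset.mem_range.1 hj
    have := l.parts_antitone (i := j + 1) (j := i + 1) (by omega) (by omega)
    omega
  simp at h2
  omega

lemma finite_size_le (n : ℕ) : {l : Partn | l.size ≤ n}.Finite := by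
  apply Set.Finite.of_injOn (f := fun (l : Partn) (i : Fin n) => l.parts (i + 1))
    (t := {g | ∀ i, g i ∈ Set.Iic n})
  · intro l hl i
    exact (l.part_le_size i).trans hl
  · intro l hl m hm h
    apply Partn.ext'
    intro i
    by_cases hi : i < n
    · exact congrFun h ⟨i, hi⟩
    · rw [l.zero_of_size n hl i (by omega), m.zero_of_size n hm i (by omega)]
  · exact Set.Finite.pi' (fun _ => Set.finite_Iic n)

/-- `λ/ν` is a horizontal strip. -/
def HS (nu lam : Partn) : Prop :=
  ∀ i, nu.parts (i + 1) ≤ lam.parts (i + 1) ∧ lam.parts (i + 2) ≤ nu.parts (i + 1)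

lemma size_mono {nu lam : Partn} (h : ∀ i, nu.parts (i + 1) ≤ lam.parts (i + 1)) :
    nu.size ≤ lam.size := by
  obtain ⟨M, hM⟩ := lam.exists_bd
  rw [lam.size_eq M hM, nu.size_eq M (fun i hi => by have := h i; rw [hM i hi] at this; omega)]
  exact Finset.sum_le_sum fun i _ => h i

lemma HS.size_le {nu lam : Partn} (h : HS nu lam) : nu.size ≤ lam.size :=
  size_mono fun i => (h i).1

lemma finite_below (lam : Partn) : {nu | HS nu lam}.Finite :=
  (finite_size_le lam.size).subset fun _ h => HS.size_le h

lemma finite_above (mu : Partn) (k : ℕ) : {lam | HS mu lam ∧ lam.size = mu.size + k}.Finite :=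
  (finite_size_le (mu.size + k)).subset fun _ h => h.2.le

lemma finite_size (n : ℕ) : {l : Partn | l.size = n}.Finite :=
  (finite_size_le n).subset fun _ h => h.le

def below (lam : Partn) : Finset Partn := (finite_below lam).toFinset
def above (mu : Partn) (k : ℕ) : Finset Partn := (finite_above mu k).toFinset
def ofSize (n : ℕ) : Finset Partn := (finite_size n).toFinset

lemma mem_below {nu lam : Partn} : nu ∈ below lam ↔ HS nu lam := by simp [below]
lemma mem_above {mu lam : Partn} {k : ℕ} :
    lam ∈ above mu k ↔ HS mu lam ∧ lam.size = mu.size + k := by simp [above]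
lemma mem_ofSize {n : ℕ} {lam : Partn} : lam ∈ ofSize n ↔ lam.size = n := by simp [ofSize]

/-- the local rule, sizes -/
lemma local_size (mu nu kap lam : Partn) (i : ℕ)
    (h1 : lam.parts 1 = max (mu.parts 1) (nu.parts 1) + i)
    (h2 : ∀ j, lam.parts (j + 2) + kap.parts (j + 1) =
      max (mu.parts (j + 2)) (nu.parts (j + 2)) + min (mu.parts (j + 1)) (nu.parts (j + 1))) :
    lam.size + kap.size = mu.size + nu.size + i := by
  obtain ⟨M1, hM1⟩ := mu.exists_bd
  obtain ⟨M2, hM2⟩ := nu.exists_bd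
  obtain ⟨M3, hM3⟩ := kap.exists_bd
  obtain ⟨M4, hM4⟩ := lam.exists_bd
  set M := M1 + M2 + M3 + M4
  rw [mu.size_eq (M + 1) (fun i hi => hM1 i (by omega)),
    nu.size_eq (M + 1) (fun i hi => hM2 i (by omega)),
    kap.size_eq M (fun i hi => hM3 i (by omega)),
    lam.size_eq (M + 1) (fun i hi => hM4 i (by omega))]
  have hm : ∀ K, ∑ j ∈ Finset.range K, mu.parts (j + 1) + ∑ j ∈ Finset.range K, nu.parts (j + 1) =
      ∑ j ∈ Finset.range K, max (mu.parts (j + 1)) (nu.parts (j + 1)) +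
      ∑ j ∈ Finset.range K, min (mu.parts (j + 1)) (nu.parts (j + 1)) := by
    intro K
    rw [← Finset.sum_add_distrib, ← Finset.sum_add_distrib]
    exact Finset.sum_congr rfl fun j _ => (max_add_min _ _).symm
  rw [hm, Finset.sum_range_succ' (fun j => lam.parts (j + 1)),
    Finset.sum_range_succ' (fun j => max (mu.parts (j + 1)) (nu.parts (j + 1))),
    Finset.sum_range_succ (fun j => min (mu.parts (j + 1)) (nu.parts (j + 1)))]
  have h3 : mu.parts (M + 1) = 0 := hM1 M (by omega)
  have h4 : ∑ j ∈ Finset.range M, lam.parts (j + 1 + 1) + ∑ j ∈ Finset.range M, kap.parts (j + 1) =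
      ∑ j ∈ Finset.range M, max (mu.parts (j + 1 + 1)) (nu.parts (j + 1 + 1)) +
      ∑ j ∈ Finset.range M, min (mu.parts (j + 1)) (nu.parts (j + 1)) := by
    rw [← Finset.sum_add_distrib, ← Finset.sum_add_distrib]
    exact Finset.sum_congr rfl fun j _ => h2 j
  simp only [zero_add, h3, Nat.zero_min, add_zero, h1]
  omega

/-- build a partition from a 0-indexed sequence -/
def mkP (f : ℕ → ℕ) (h : ∀ i, f (i + 1) ≤ f i) (M : ℕ) (hM : ∀ i, M ≤ i → f i = 0) : Partn where
  parts := fun i => if i = 0 then 0 else f (i - 1)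
  parts_zero := by simp
  parts_antitone := by
    intro i j hi hij
    have : Antitone f := antitone_nat_of_succ_le h
    rw [if_neg (by omega), if_neg (by omega)]
    exact this (by omega)
  parts_finite := (Set.finite_Iic M).subset (by
    intro i hi
    simp only [Set.mem_setOf_eq] at hi
    by_contra h'
    simp only [Set.mem_Iic] at h'
    rw [if_neg (by omega), hM _ (by omega)] at hi
    exact hi rfl)

lemma mkP_parts (f : ℕ → ℕ) (h M hM) (i : ℕ) : (mkP f h M hM).parts (i + 1) = f i := by
  simp [mkP]

lemma exists_up (mu nu kap : Partn) (i : ℕ) (h1 : HS kap mu) (h2 : HS kap nu) :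
    ∃ lam : Partn, lam.parts 1 = max (mu.parts 1) (nu.parts 1) + i ∧
      ∀ j, lam.parts (j + 2) = max (mu.parts (j + 2)) (nu.parts (j + 2)) +
        min (mu.parts (j + 1)) (nu.parts (j + 1)) - kap.parts (j + 1) := by
  obtain ⟨M1, hM1⟩ := mu.exists_bd
  obtain ⟨M2, hM2⟩ := nu.exists_bd
  refine ⟨mkP (fun j => match j with
    | 0 => max (mu.parts 1) (nu.parts 1) + i
    | j + 1 => max (mu.parts (j + 2)) (nu.parts (j + 2)) +
        min (mu.parts (j + 1)) (nu.parts (j + 1)) - kap.parts (j + 1)) ?_ (M1 + M2 + 1) ?_, ?_, ?_⟩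
  · intro j
    match j with
    | 0 =>
      have := h1 0; have := h2 0
      simp only [zero_add] at *
      omega
    | j + 1 =>
      have := h1 j; have := h2 j; have := h1 (j + 1); have := h2 (j + 1)
      simp only [add_assoc, Nat.reduceAdd] at *
      omega
  · intro j hj
    match j with
    | 0 => omega
    | j + 1 =>
      have := hM1 j (by omega); have := hM1 (j + 1) (by omega)
      have := hM2 j (by omega); have := hM2 (j + 1) (by omega)
      simp only [add_assoc, Nat.reduceAdd] at *
      omega
  · exact mkP_parts _ _ _ _ 0
  · intro j
    exact mkP_parts _ _ _ _ (j + 1)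

lemma exists_down (mu nu lam : Partn) (h1 : HS mu lam) (h2 : HS nu lam) :
    ∃ kap : Partn, 
      ∀ j, kap.parts (j + 1) = max (mu.parts (j + 2)) (nu.parts (j + 2)) +
        min (mu.parts (j + 1)) (nu.parts (j + 1)) - lam.parts (j + 2) := by
  obtain ⟨M1, hM1⟩ := mu.exists_bd
  obtain ⟨M2, hM2⟩ := nu.exists_bd
  refine ⟨mkP (fun j => max (mu.parts (j + 2)) (nu.parts (j + 2)) +
        min (mu.parts (j + 1)) (nu.parts (j + 1)) - lam.parts (j + 2)) ?_ (M1 + M2) ?_, ?_⟩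
  · intro j
    have := h1 j; have := h2 j; have := h1 (j + 1); have := h2 (j + 1)
    have := h1 (j + 2); have := h2 (j + 2)
    simp only [add_assoc, Nat.reduceAdd] at *
    omega
  · intro j hj
    have := hM1 j (by omega); have := hM1 (j + 1) (by omega)
    have := hM2 j (by omega); have := hM2 (j + 1) (by omega)
    simp only [add_assoc, Nat.reduceAdd] at *
    omega
  · intro j
    exact mkP_parts _ _ _ _ j

lemma local_rule (mu nu : Partn) (k : ℕ) :
    ((above mu k).filter (fun lam => HS nu lam)).card =
    ((below mu).filter (fun kap => HS kap nu ∧ nu.size ≤ kap.size + k)).card := by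
  symm
  have up : ∀ kap ∈ (below mu).filter (fun kap => HS kap nu ∧ nu.size ≤ kap.size + k),
      HS kap mu ∧ HS kap nu ∧ nu.size ≤ kap.size + k := by
    intro kap h
    simpa [mem_below] using h
  have dn : ∀ lam ∈ (above mu k).filter (fun lam => HS nu lam),
      HS mu lam ∧ HS nu lam ∧ lam.size = mu.size + k := by
    intro lam h
    simp [mem_above] at h
    tauto
  refine Finset.card_bij' (fun kap h => (exists_up mu nu kap (kap.size + k - nu.size)
    (up kap h).1 (up kap h).2.1).choose) 
    (fun lam h => (exists_down mu nu lam (dn lam h).1 (dn lam h).2.1).choose) ?_ ?_ ?_ ?_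
  · intro kap h
    obtain ⟨a, b, c⟩ := up kap h
    generalize_proofs pf
    obtain ⟨h1, h2⟩ := pf.choose_spec
    generalize pf.choose = lam at *
    have hs := local_size mu nu kap lam _ h1 (fun j => by
      have := h2 j; have := a j; have := b j; omega)
    simp only [Finset.mem_filter, mem_above]
    refine ⟨⟨?_, by omega⟩, ?_⟩
    · intro j
      refine ⟨?_, ?_⟩
      · cases j with
        | zero => simp only [zero_add] at *; omega
        | succ j =>
          have := h2 j; have := a j; have := b j
          simp only [add_assoc, Nat.reduceAdd] at *; omega
      · have := h2 j; have := a j; have := b j; omega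
    · intro j
      refine ⟨?_, ?_⟩
      · cases j with
        | zero => simp only [zero_add] at *; omega
        | succ j =>
          have := h2 j; have := a j; have := b j
          simp only [add_assoc, Nat.reduceAdd] at *; omega
      · have := h2 j; have := a j; have := b j; omega
  · intro lam h
    obtain ⟨a, b, c⟩ := dn lam h
    generalize_proofs pf
    have h2 := pf.choose_spec
    generalize pf.choose = kap at *
    have a0 := a 0
    have b0 := b 0
    simp only [zero_add] at a0 b0
    have hs := local_size mu nu kap lam (lam.parts 1 - max (mu.parts 1) (nu.parts 1))
      (by omega) (fun j => by
      have := h2 j; have := a j; have := b j; have := a (j + 1); have := b (j + 1)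
      simp only [add_assoc, Nat.reduceAdd] at *; omega)
    simp only [Finset.mem_filter, mem_below]
    refine ⟨?_, ?_, by omega⟩
    · intro j
      have := h2 j; have := a j; have := b j; have := a (j + 1); have := b (j + 1)
      simp only [add_assoc, Nat.reduceAdd] at *; omega
    · intro j
      have := h2 j; have := a j; have := b j; have := a (j + 1); have := b (j + 1)
      simp only [add_assoc, Nat.reduceAdd] at *; omega
  · intro kap h
    obtain ⟨a, b, c⟩ := up kap h
    generalize_proofs pf qf
    obtain ⟨h1, h2⟩ := pf.choose_spec
    have h3 := qf.choose_spec
    generalize qf.choose = kap' at *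
    generalize pf.choose = lam at *
    apply Partn.ext'
    intro j
    have := h2 j; have := a j; have := b j; have := h3 j
    omega
  · intro lam h
    obtain ⟨a, b, c⟩ := dn lam h
    generalize_proofs pf qf
    have h2 := pf.choose_spec
    obtain ⟨h3, h4⟩ := qf.choose_spec
    generalize qf.choose = lam' at *
    generalize pf.choose = kap at *
    have a0 := a 0
    have b0 := b 0
    simp only [zero_add] at a0 b0
    have hs := local_size mu nu kap lam (lam.parts 1 - max (mu.parts 1) (nu.parts 1))
      (by omega) (fun j => by
      have := h2 j; have := a j; have := b j; have := a (j + 1); have := b (j + 1)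
      simp only [add_assoc, Nat.reduceAdd] at *; omega)
    apply Partn.ext'
    intro j
    cases j with
    | zero => simp only [zero_add] at *; omega
    | succ j =>
      have := h2 j; have := a j; have := b j; have := a (j + 1); have := b (j + 1)
      have := h4 j
      simp only [add_assoc, Nat.reduceAdd] at *; omega

lemma size_empty : Partn.empty.size = 0 := by
  rw [Partn.size_eq _ 0 (fun _ _ => rfl)]; simp

lemma size_ofRow (k : ℕ) : (Partn.ofRow k).size = k := by
  rw [Partn.size_eq _ 1 (fun i hi => by simp [Partn.ofRow]; omega)]; simp [Partn.ofRow]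

lemma size_eq_zero {l : Partn} (h : l.size = 0) : l = Partn.empty := by
  apply Partn.ext'
  intro i
  rw [l.zero_of_size 0 h.le i (by omega)]; rfl

lemma HS_empty_iff {nu : Partn} : HS nu Partn.empty ↔ nu = Partn.empty := by
  constructor
  · intro h
    apply size_eq_zero
    have := h.size_le
    rw [size_empty] at this
    omega
  · rintro rfl i
    exact ⟨le_rfl, le_rfl⟩

lemma below_empty : below Partn.empty = {Partn.empty} := by
  ext nu; simp [mem_below, HS_empty_iff]

lemma above_empty (k : ℕ) : above Partn.empty k = {Partn.ofRow k} := by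
  ext lam
  rw [mem_above, Finset.mem_singleton, size_empty, zero_add]
  constructor
  · rintro ⟨h, hs⟩
    have h2 : ∀ i, lam.parts (i + 2) = 0 := by
      intro i
      have := (h i).2
      simpa [Partn.empty] using this
    apply Partn.ext'
    intro i
    cases i with
    | zero =>
      rw [lam.size_eq 1 (fun i hi => by
        obtain ⟨j, rfl⟩ : ∃ j, i = j + 1 := ⟨i - 1, by omega⟩
        exact h2 j)] at hs
      simpa [Partn.ofRow] using hs
    | succ j => rw [h2 j]; simp [Partn.ofRow]
  · rintro rfl
    refine ⟨fun i => ?_, size_ofRow k⟩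
    simp [Partn.empty, Partn.ofRow]

def SS : ℕ → Partn → MvPowerSeries ℕ ℂ
  | 0, lam => if lam = Partn.empty then 1 else 0
  | N + 1, lam => ∑ nu ∈ below lam, SS N nu * MvPowerSeries.X N ^ (lam.size - nu.size)

def HH : ℕ → ℕ → MvPowerSeries ℕ ℂ
  | 0, k => if k = 0 then 1 else 0
  | N + 1, k => ∑ i ∈ Finset.range (k + 1), HH N (k - i) * MvPowerSeries.X N ^ i

lemma SS_pieri (N : ℕ) : ∀ (mu : Partn) (k : ℕ),
    SS N mu * HH N k = ∑ lam ∈ above mu k, SS N lam := by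
  induction N with
  | zero =>
    intro mu k
    simp only [SS, HH]
    rw [Finset.sum_ite_eq']
    simp only [mem_above, size_empty]
    by_cases h : mu = Partn.empty
    · subst h
      by_cases hk : k = 0
      · simp [hk, size_empty, HS_empty_iff]
      · simp [hk, size_empty, Ne.symm hk]
    · simp [h, HS_empty_iff]
  | succ N ih =>
    intro mu k
    set U : Finset Partn := (finite_size_le (mu.size + k)).toFinset with hU
    have mU : ∀ l, l ∈ U ↔ l.size ≤ mu.size + k := by intro l; simp [hU]
    have hR : ∑ lam ∈ above mu k, SS (N + 1) lam =
        ∑ nu ∈ U, ∑ kap ∈ (below mu).filter (fun kap => HS kap nu ∧ nu.size ≤ kap.size + k),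
          SS N nu * MvPowerSeries.X N ^ (mu.size + k - nu.size) := by
      calc ∑ lam ∈ above mu k, SS (N + 1) lam
          = ∑ lam ∈ above mu k, ∑ nu ∈ below lam,
            SS N nu * MvPowerSeries.X N ^ (mu.size + k - nu.size) := by
            apply Finset.sum_congr rfl
            intro lam hl
            rw [mem_above] at hl
            simp only [SS, hl.2]
        _ = ∑ nu ∈ U, ∑ lam ∈ (above mu k).filter (fun lam => HS nu lam),
            SS N nu * MvPowerSeries.X N ^ (mu.size + k - nu.size) := by
            apply Finset.sum_comm'
            intro lam nu
            rw [mem_below, mU, Finset.mem_filter, mem_above]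
            constructor
            · rintro ⟨⟨h1, h2⟩, h3⟩
              exact ⟨⟨⟨h1, h2⟩, h3⟩, h2 ▸ h3.size_le⟩
            · rintro ⟨⟨⟨h1, h2⟩, h3⟩, -⟩
              exact ⟨⟨h1, h2⟩, h3⟩
        _ = _ := by
            apply Finset.sum_congr rfl
            intro nu _
            rw [Finset.sum_const, Finset.sum_const, local_rule]
    have hL : SS (N + 1) mu * HH (N + 1) k =
        ∑ kap ∈ below mu, ∑ nu ∈ U.filter (fun nu => HS kap nu ∧ nu.size ≤ kap.size + k),
          SS N nu * MvPowerSeries.X N ^ (mu.size + k - nu.size) := by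
      simp only [SS, HH]
      rw [Finset.sum_mul]
      apply Finset.sum_congr rfl
      intro kap hkap
      rw [mem_below] at hkap
      have hle := hkap.size_le
      rw [Finset.mul_sum, ← Finset.sum_fiberwise_of_maps_to (s := U.filter _)
        (t := Finset.range (k + 1)) (g := fun nu => kap.size + k - nu.size)]
      · apply Finset.sum_congr rfl
        intro i hi
        rw [Finset.mem_range] at hi
        have : SS N kap * MvPowerSeries.X N ^ (mu.size - kap.size) *
            (HH N (k - i) * MvPowerSeries.X N ^ i) = (SS N kap * HH N (k - i)) *
            MvPowerSeries.X N ^ (mu.size - kap.size + i) := by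
          rw [pow_add]; ring
        rw [this, ih, Finset.sum_mul]
        apply Finset.sum_congr
        · ext nu
          simp only [mem_above, Finset.mem_filter, mU]
          constructor
          · rintro ⟨h1, h2⟩
            refine ⟨⟨?_, h1, ?_⟩, ?_⟩ <;> omega
          · rintro ⟨⟨h1, h2, h3⟩, h4⟩
            have := h2.size_le
            refine ⟨h2, ?_⟩
            omega
        · intro nu hnu
          simp only [Finset.mem_filter] at hnu
          have := hnu.1.2.1.size_le
          congr 2
          omega
      · intro nu hnu
        simp only [Finset.mem_filter, mU] at hnu
        have := hnu.2.1.size_le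
        rw [Finset.mem_range]
        omega
    rw [hL, hR]
    apply Finset.sum_comm'
    intro kap nu
    simp only [Finset.mem_filter]
    tauto

lemma SS_empty (N : ℕ) : SS N Partn.empty = 1 := by
  induction N with
  | zero => simp [SS]
  | succ N ih => simp [SS, below_empty, ih]

lemma HH_eq (N k : ℕ) : HH N k = SS N (Partn.ofRow k) := by
  have := SS_pieri N Partn.empty k
  rwa [SS_empty, one_mul, above_empty, Finset.sum_singleton] at this

/-! tableaux -/

lemma cells_eq (l : Partn) (M : ℕ) (hM : ∀ i, M ≤ i → l.parts (i + 1) = 0) :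
    {c | l.cell c} = (((Finset.range M).sigma (fun i => Finset.range (l.parts (i + 1)))).image
      (fun x => (x.1 + 1, x.2 + 1)) : Finset (ℕ × ℕ)) := by
  ext ⟨i, j⟩
  simp only [Partn.cell, Set.mem_ofPred_eq, Finset.coe_image, Set.mem_image, Finset.mem_coe,
    Finset.mem_sigma, Finset.mem_range, Prod.mk.injEq]
  constructor
  · rintro ⟨h1, h2, h3⟩
    refine ⟨⟨i - 1, j - 1⟩, ⟨?_, ?_⟩, Nat.sub_add_cancel h1, Nat.sub_add_cancel h2⟩
    · by_contra h
      have := hM (i - 1) (by simpa using h)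
      rw [Nat.sub_add_cancel h1] at this
      omega
    · simp only [Nat.sub_add_cancel h1]; omega
  · rintro ⟨⟨a, b⟩, ⟨h1, h2⟩, rfl, rfl⟩
    refine ⟨by omega, by omega, h2⟩

lemma cells_finite (l : Partn) : {c | l.cell c}.Finite := by
  obtain ⟨M, hM⟩ := l.exists_bd
  rw [cells_eq l M hM]
  exact Finset.finite_toSet _

lemma cells_card (l : Partn) : {c | l.cell c}.ncard = l.size := by
  obtain ⟨M, hM⟩ := l.exists_bd
  rw [cells_eq l M hM, Set.ncard_coe_finset, Finset.card_image_of_injective, Finset.card_sigma,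
    l.size_eq M hM]
  · simp
  · rintro ⟨a, b⟩ ⟨c, d⟩ h
    simp at h
    simp [h]

lemma cell_up {l : Partn} {i j : ℕ} (h : l.cell (i + 1, j)) (hi : 1 ≤ i) : l.cell (i, j) := by
  obtain ⟨h1, h2, h3⟩ := h
  exact ⟨hi, h2, h3.trans (l.parts_antitone hi (by simp))⟩

lemma cell_left {l : Partn} {i j : ℕ} (h : l.cell (i, j + 1)) (hj : 1 ≤ j) : l.cell (i, j) := by
  obtain ⟨h1, h2, h3⟩ := h
  simp only at h3
  exact ⟨h1, hj, by simp only; omega⟩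

lemma SympTab.ext' {lam : Partn} {T T' : SympTab lam} (h : ∀ c, lam.cell c → T.entry c = T'.entry c) :
    T = T' := by
  have : T.entry = T'.entry := by
    funext c
    by_cases hc : lam.cell c
    · exact h c hc
    · rw [T.entry_outside c hc, T'.entry_outside c hc]
  cases T; cases T'; simp only at this; subst this; rfl

lemma SSYT.ext' {lam : Partn} {T T' : SSYT lam} (h : ∀ c, lam.cell c → T.entry c = T'.entry c) :
    T = T' := by
  have : T.entry = T'.entry := by
    funext c
    by_cases hc : lam.cell c
    · exact h c hc
    · rw [T.entry_outside c hc, T'.entry_outside c hc]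
  cases T; cases T'; simp only at this; subst this; rfl

def SympTab.cnt {lam : Partn} (T : SympTab lam) (k : ℕ) : ℕ :=
  {c : ℕ × ℕ | lam.cell c ∧ T.entry c = k}.ncard

def SympTab.bd {lam : Partn} (T : SympTab lam) (N : ℕ) : Prop :=
  ∀ c, lam.cell c → T.entry c < N

lemma finite_bd (lam : Partn) (N : ℕ) : Finite {T : SympTab lam // T.bd N} := by
  have := (cells_finite lam).to_subtype
  refine Finite.of_injective (β := {c | lam.cell c} → Fin N)
    (fun T c => ⟨T.1.entry c.1, T.2 c.1 c.2⟩) ?_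
  intro T T' h
  apply Subtype.ext
  apply SympTab.ext'
  intro c hc
  have := congrFun h ⟨c, hc⟩
  simpa using this

instance finite_bd' (lam : Partn) (N : ℕ) (Q : SympTab lam → Prop) :
    Finite {T : SympTab lam // T.bd N ∧ Q T} := by
  have := finite_bd lam N
  exact Finite.of_injective (β := {T : SympTab lam // T.bd N}) (fun T => ⟨T.1, T.2.1⟩)
    (fun a b h => Subtype.ext (by simpa using h))

def count (lam : Partn) (N : ℕ) (Q : (ℕ → ℕ) → Prop) : ℕ :=
  Nat.card {T : SympTab lam // T.bd N ∧ Q T.cnt}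

lemma card_split {α β : Type*} (A : α → Prop) [Finite {a // A a}] (s : Finset β)
    (B : α → β → Prop) (h : ∀ a, A a → ∃ b ∈ s, B a b)
    (hu : ∀ a b b', A a → B a b → B a b' → b = b') :
    Nat.card {a // A a} = ∑ b ∈ s, Nat.card {a // A a ∧ B a b} := by
  have e : {a // A a} ≃ Σ b : s, {a // A a ∧ B a b.1} :=
    { toFun := fun a => ⟨⟨(h a.1 a.2).choose, (h a.1 a.2).choose_spec.1⟩,
        ⟨a.1, a.2, (h a.1 a.2).choose_spec.2⟩⟩
      invFun := fun x => ⟨x.2.1, x.2.2.1⟩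
      left_inv := fun a => rfl
      right_inv := by
        rintro ⟨⟨b, hb⟩, ⟨a, ha, hB⟩⟩
        obtain rfl : b = (h a ha).choose := hu a _ _ ha hB (h a ha).choose_spec.2
        rfl }
  have hf : ∀ b : s, Finite {a // A a ∧ B a b.1} := fun b =>
    Finite.of_injective (β := {a // A a}) (fun T => ⟨T.1, T.2.1⟩)
      (fun a b h => Subtype.ext (by simpa using h))
  rw [Nat.card_congr e, Nat.card_sigma]
  exact Finset.sum_coe_sort s (fun b => Nat.card {a // A a ∧ B a b})

lemma le_of_cells {a b : ℕ} (h : 1 ≤ a → a ≤ b) : a ≤ b := by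
  by_cases ha : 1 ≤ a
  · exact h ha
  · omega

lemma cell_ext {mu nu : Partn} (h : ∀ c, mu.cell c ↔ nu.cell c) : mu = nu := by
  apply Partn.ext'
  intro i
  apply le_antisymm
  · exact le_of_cells fun h1 => ((h (i + 1, mu.parts (i + 1))).1 ⟨by simp, h1, le_rfl⟩).2.2
  · exact le_of_cells fun h1 => ((h (i + 1, nu.parts (i + 1))).2 ⟨by simp, h1, le_rfl⟩).2.2

lemma HS.cell {nu lam : Partn} (h : HS nu lam) {c : ℕ × ℕ} (hc : nu.cell c) : lam.cell c := by
  obtain ⟨i, j⟩ := c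
  obtain ⟨h1, h2, h3⟩ := hc
  simp only at h1 h2 h3
  refine ⟨h1, h2, h3.trans ?_⟩
  have := (h (i - 1)).1
  rwa [Nat.sub_add_cancel h1] at this

lemma HS.cell' {nu lam : Partn} (h : HS nu lam) {i j : ℕ} (hi : 1 ≤ i) (hc : lam.cell (i + 1, j)) :
    nu.cell (i, j) := by
  obtain ⟨h1, h2, h3⟩ := hc
  simp only at h1 h2 h3
  refine ⟨hi, h2, h3.trans ?_⟩
  obtain ⟨i, rfl⟩ : ∃ k, i = k + 1 := ⟨i - 1, by omega⟩
  exact (h i).2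

lemma SympTab.row_mono {lam : Partn} (T : SympTab lam) (i j t : ℕ) (hc : lam.cell (i, j + t)) :
    T.entry (i, j) ≤ T.entry (i, j + t) := by
  induction t with
  | zero => exact le_rfl
  | succ t ih =>
    by_cases h : 1 ≤ j + t
    · exact (ih (cell_left hc h)).trans (T.row_weak i (j + t) hc)
    · have : j = 0 := by omega
      subst this
      rw [T.entry_outside (i, 0) (fun h => by have := h.2.1; simp at this)]
      exact Nat.zero_le _

def SympTab.Sub {lam : Partn} (T : SympTab lam) (N : ℕ) (nu : Partn) : Prop :=
  ∀ c, nu.cell c ↔ lam.cell c ∧ T.entry c < N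

lemma exists_sub {lam : Partn} (T : SympTab lam) (N : ℕ) : ∃ nu, T.Sub N nu := by
  obtain ⟨M, hM⟩ := lam.exists_bd
  have key : ∀ i j, 1 ≤ j → (j ≤ Nat.findGreatest (fun j => 1 ≤ j ∧ T.entry (i + 1, j) < N)
      (lam.parts (i + 1)) ↔ lam.cell (i + 1, j) ∧ T.entry (i + 1, j) < N) := by
    intro i j hj
    constructor
    · intro h
      have h2 := Nat.findGreatest_le (P := fun j => 1 ≤ j ∧ T.entry (i + 1, j) < N)
        (lam.parts (i + 1))
      have h1 := Nat.findGreatest_of_ne_zero (P := fun j => 1 ≤ j ∧ T.entry (i + 1, j) < N)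
        (n := lam.parts (i + 1)) rfl (by omega)
      generalize Nat.findGreatest (fun j => 1 ≤ j ∧ T.entry (i + 1, j) < N)
        (lam.parts (i + 1)) = v at *
      refine ⟨⟨by simp, hj, h.trans h2⟩, ?_⟩
      obtain ⟨t, rfl⟩ := Nat.exists_eq_add_of_le h
      exact (T.row_mono (i + 1) j t ⟨by simp, by simp only; omega, h2⟩).trans_lt h1.2
    · rintro ⟨h1, h2⟩
      exact Nat.le_findGreatest h1.2.2 ⟨hj, h2⟩
  refine ⟨mkP (fun i => Nat.findGreatest (fun j => 1 ≤ j ∧ T.entry (i + 1, j) < N)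
    (lam.parts (i + 1))) ?_ M ?_, ?_⟩
  · intro i
    apply le_of_cells
    intro h1
    rw [key _ _ h1]
    obtain ⟨h2, h3⟩ := (key _ _ h1).1 le_rfl
    exact ⟨cell_up h2 (by omega), (T.col_strict _ _ (by omega) h2).trans h3⟩
  · intro i hi
    have := Nat.findGreatest_le (P := fun j => 1 ≤ j ∧ T.entry (i + 1, j) < N) (lam.parts (i + 1))
    rw [hM i hi] at this ⊢
    omega
  · rintro ⟨i, j⟩
    by_cases hi : 1 ≤ i
    · by_cases hj : 1 ≤ j
      · obtain ⟨i, rfl⟩ : ∃ k, i = k + 1 := ⟨i - 1, by omega⟩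
        rw [← key i j hj]
        simp only [Partn.cell, mkP_parts]
        simp [hj]
      · simp [Partn.cell, hj]
    · simp [Partn.cell, hi]

lemma HS_of_sub {lam : Partn} {T : SympTab lam} {N : ℕ} {nu : Partn} (hb : T.bd (N + 1))
    (h : T.Sub N nu) : HS nu lam := by
  intro i
  constructor
  · exact le_of_cells fun h1 => ((h (i + 1, nu.parts (i + 1))).1 ⟨by simp, h1, le_rfl⟩).1.2.2
  · apply le_of_cells
    intro h1
    have hc : lam.cell (i + 1 + 1, lam.parts (i + 2)) := ⟨by simp, h1, le_rfl⟩
    have h2 := hb _ hc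
    have h3 := T.col_strict _ _ (by omega) hc
    exact ((h (i + 1, lam.parts (i + 2))).2 ⟨cell_up hc (by omega), by omega⟩).2.2

def SympTab.restr {lam : Partn} (T : SympTab lam) (nu : Partn) (h : HS nu lam) : SympTab nu where
  entry := fun c => if nu.cell c then T.entry c else 0
  entry_outside := fun c hc => if_neg hc
  row_weak := by
    intro i j hc
    rw [if_pos hc]
    split_ifs with h1
    · exact T.row_weak i j (h.cell hc)
    · exact Nat.zero_le _
  col_strict := by
    intro i j hi hc
    rw [if_pos hc, if_pos (cell_up hc hi)]
    exact T.col_strict i j hi (h.cell hc)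

def SympTab.extend {nu : Partn} (T : SympTab nu) (lam : Partn) (h : HS nu lam) (N : ℕ)
    (hb : T.bd N) : SympTab lam where
  entry := fun c => if nu.cell c then T.entry c else if lam.cell c then N else 0
  entry_outside := fun c hc => by rw [if_neg (fun h' => hc (h.cell h')), if_neg hc]
  row_weak := by
    intro i j hc
    by_cases h1 : nu.cell (i, j + 1)
    · rw [if_pos h1]
      by_cases hj : 1 ≤ j
      · rw [if_pos (cell_left h1 hj)]
        exact T.row_weak i j h1
      · have : ∀ l : Partn, ¬ l.cell (i, j) := fun l h' => hj h'.2.1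
        rw [if_neg (this _), if_neg (this _)]
        exact Nat.zero_le _
    · rw [if_neg h1, if_pos hc]
      split_ifs with h2
      · exact (hb _ h2).le
      · exact le_rfl
      · exact Nat.zero_le _
  col_strict := by
    intro i j hi hc
    rw [if_pos (h.cell' hi hc)]
    split_ifs with h2
    · exact T.col_strict i j hi h2
    · exact hb _ (h.cell' hi hc)

lemma cnt_eq_of_sub {lam nu : Partn} {T : SympTab lam} {T' : SympTab nu} {N : ℕ}
    (h : T.Sub N nu) (hT : ∀ c, nu.cell c → T'.entry c = T.entry c) (k : ℕ) (hk : k < N) :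
    T.cnt k = T'.cnt k := by
  unfold SympTab.cnt
  congr 1
  ext c
  simp only [Set.mem_ofPred_eq]
  constructor
  · rintro ⟨h1, h2⟩
    have := (h c).2 ⟨h1, by omega⟩
    exact ⟨this, by rw [hT c this, h2]⟩
  · rintro ⟨h1, h2⟩
    exact ⟨((h c).1 h1).1, by rw [← hT c h1, h2]⟩

lemma cnt_top {lam nu : Partn} {T : SympTab lam} {N : ℕ} (hb : T.bd (N + 1))
    (h : T.Sub N nu) : lam.size = nu.size + T.cnt N := by
  rw [← cells_card, ← cells_card, SympTab.cnt, ← Set.ncard_union_eq ?_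
    (cells_finite _) ((cells_finite lam).subset fun c hc => hc.1)]
  · congr 1
    ext c
    simp only [Set.mem_ofPred_eq, Set.mem_union, h c]
    constructor
    · intro hc
      have := hb c hc
      by_cases h1 : T.entry c < N
      · exact Or.inl ⟨hc, h1⟩
      · exact Or.inr ⟨hc, by omega⟩
    · tauto
  · rw [Set.disjoint_left]
    intro c h1 h2
    have h3 := ((h c).1 h1).2
    have h4 := h2.2
    omega

lemma count_rec (lam : Partn) (N k : ℕ) (Q : (ℕ → ℕ) → Prop)
    (hQ : ∀ f g : ℕ → ℕ, (∀ k < N, f k = g k) → (Q f ↔ Q g)) :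
    count lam (N + 1) (fun f => Q f ∧ f N = k) =
      ∑ nu ∈ below lam, if lam.size = nu.size + k then count nu N Q else 0 := by
  unfold count
  rw [card_split _ (below lam) (fun T nu => T.Sub N nu)]
  · apply Finset.sum_congr rfl
    intro nu hnu
    rw [mem_below] at hnu
    split_ifs with hs
    · refine Nat.card_congr
        { toFun := fun T => ⟨T.1.restr nu hnu, ?_, ?_⟩
          invFun := fun T => ⟨T.1.extend lam hnu N T.2.1, ⟨?_, ?_, ?_⟩, ?_⟩
          left_inv := ?_
          right_inv := ?_ }
      · intro c hc
        have := ((T.2.2 c).1 hc).2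
        simp only [SympTab.restr, if_pos hc]
        exact this
      · refine (hQ _ _ (fun k hk => cnt_eq_of_sub T.2.2 ?_ k hk)).1 T.2.1.2.1
        intro c hc
        simp [SympTab.restr, hc]
      all_goals try
        have hsub : (T.1.extend lam hnu N T.2.1).Sub N nu := by
          intro c
          constructor
          · intro hc
            refine ⟨hnu.cell hc, ?_⟩
            simp only [SympTab.extend, if_pos hc]
            exact T.2.1 c hc
          · rintro ⟨h1, h2⟩
            by_contra hc
            simp [SympTab.extend, hc, h1] at h2
        have hbd : (T.1.extend lam hnu N T.2.1).bd (N + 1) := by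
          intro c hc
          by_cases h : nu.cell c
          · have := T.2.1 c h
            simp only [SympTab.extend, if_pos h]
            omega
          · simp [SympTab.extend, h, hc]
      · exact hbd
      · refine (hQ _ _ (fun k hk => cnt_eq_of_sub hsub ?_ k hk)).2 T.2.2
        intro c hc
        simp [SympTab.extend, hc]
      · have := cnt_top hbd hsub
        omega
      · exact hsub
      · rintro ⟨T, ⟨h1, h2, h3⟩, h4⟩
        apply Subtype.ext
        apply SympTab.ext'
        intro c hc
        by_cases h : nu.cell c
        · simp [SympTab.extend, SympTab.restr, h]
        · have h5 := h1 c hc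
          have h6 : ¬ T.entry c < N := fun h' => h ((h4 c).2 ⟨hc, h'⟩)
          simp only [SympTab.extend, if_neg h, if_pos hc]
          omega
      · rintro ⟨T, h1, h2⟩
        apply Subtype.ext
        apply SympTab.ext'
        intro c hc
        simp [SympTab.extend, SympTab.restr, hc]
    · rw [Nat.card_eq_zero]
      left
      refine ⟨fun T => hs ?_⟩
      have := cnt_top T.2.1.1 T.2.2
      rw [T.2.1.2.2] at this
      exact this
  · intro T hT
    obtain ⟨nu, h⟩ := exists_sub T N
    exact ⟨nu, mem_below.2 (HS_of_sub hT.1 h), h⟩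
  · intro T nu nu' _ h1 h2
    exact cell_ext fun c => (h1 c).trans (h2 c).symm

lemma count_empty (Q : (ℕ → ℕ) → Prop) (hQ : ∀ f, Q f) (lam : Partn) :
    count lam 0 Q = if lam = Partn.empty then 1 else 0 := by
  unfold count
  split_ifs with h
  · subst h
    have hc : ∀ c, ¬ Partn.empty.cell c := by
      intro c h
      have h1 := h.2.1
      have h2 := h.2.2
      simp [Partn.empty] at h2
      omega
    rw [Nat.card_eq_one_iff_unique]
    refine ⟨⟨fun a b => Subtype.ext (SympTab.ext' fun c h => absurd h (hc c))⟩,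
      ⟨⟨⟨fun _ => 0, fun _ _ => rfl, fun _ _ _ => le_rfl, fun _ _ _ h => absurd h (hc _)⟩,
        fun c h => absurd h (hc c), hQ _⟩⟩⟩
  · rw [Nat.card_eq_zero]
    left
    refine ⟨fun T => h (cell_ext fun c => ?_)⟩
    constructor
    · intro hc
      have := T.2.1 c hc
      omega
    · intro h
      have h1 := h.2.1
      have h2 := h.2.2
      simp [Partn.empty] at h2
      omega

lemma count_congr {lam : Partn} {N : ℕ} {Q Q' : (ℕ → ℕ) → Prop} (h : ∀ f, Q f ↔ Q' f) :
    count lam N Q = count lam N Q' := by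
  have : Q = Q' := funext fun f => propext (h f)
  rw [this]

lemma coeff_SS (N : ℕ) : ∀ (lam : Partn) (d : ℕ →₀ ℕ), MvPowerSeries.coeff d (SS N lam) =
    if (∀ k, N ≤ k → d k = 0) then (count lam N (fun f => ∀ k < N, f k = d k) : ℂ) else 0 := by
  induction N with
  | zero =>
    intro lam d
    rw [count_empty _ (by simp)]
    have : (∀ k, 0 ≤ k → d k = 0) ↔ d = 0 := by
      simp [Finsupp.ext_iff]
    simp only [this, SS]
    by_cases h : lam = Partn.empty
    · simp [h, MvPowerSeries.coeff_one]
    · simp [h]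
  | succ N ih =>
    intro lam d
    have hQ : (count lam (N + 1) (fun f => ∀ k < N + 1, f k = d k)) =
        count lam (N + 1) (fun f => (∀ k < N, f k = d k) ∧ f N = d N) := by
      apply count_congr
      intro f
      rw [Nat.forall_lt_succ_right]
    rw [hQ, count_rec lam N (d N) (fun f => ∀ k < N, f k = d k) (by
      intro f g h
      constructor
      · intro h' k hk; rw [← h k hk, h' k hk]
      · intro h' k hk; rw [h k hk, h' k hk])]
    simp only [SS, map_sum]
    have h0 : ∀ nu ∈ below lam, MvPowerSeries.coeff d (SS N nu * MvPowerSeries.X N ^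
        (lam.size - nu.size)) = if (∀ k, N + 1 ≤ k → d k = 0) then
          (if lam.size = nu.size + d N then
            (count nu N (fun f => ∀ k < N, f k = d k) : ℂ) else 0) else 0 := by
      intro nu hnu
      have hle := (mem_below.1 hnu).size_le
      rw [MvPowerSeries.X_pow_eq, MvPowerSeries.coeff_mul_monomial, mul_one, ih]
      simp only [Finsupp.single_le_iff]
      by_cases h1 : ∀ k, N + 1 ≤ k → d k = 0
      · rw [if_pos h1]
        by_cases h2 : lam.size = nu.size + d N
        · rw [if_pos h2, if_pos (by omega), if_pos]
          · congr 1
            apply count_congr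
            intro f
            apply forall_congr'
            intro k
            apply forall_congr'
            intro hk
            have : N ≠ k := by omega
            simp [this]
          · intro k hk
            rcases Nat.eq_or_lt_of_le hk with rfl | hk
            · simp; omega
            · simp [h1 k hk]
        · rw [if_neg h2]
          by_cases h3 : lam.size - nu.size ≤ d N
          · rw [if_pos h3, if_neg]
            intro h
            have := h N le_rfl
            simp at this
            omega
          · rw [if_neg h3]
      · rw [if_neg h1]
        split_ifs with h2 h3
        · exfalso
          apply h1
          intro k hk
          have := h3 k (by omega)
          have hk' : N ≠ k := by omega
          simpa [hk'] using this
        · rfl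
        · rfl
    rw [Finset.sum_congr rfl h0]
    split_ifs with h
    · push_cast
      rfl
    · simp

lemma coeff_sSchur (N : ℕ) (lam : Partn) (d : ℕ →₀ ℕ) (hd : ∀ k, N ≤ k → d k = 0) :
    MvPowerSeries.coeff d (sSchur lam) = (count lam N (fun f => ∀ k < N, f k = d k) : ℂ) := by
  show (Nat.card {T : SSYT lam // ∀ k, 1 ≤ k → T.wt k = d (k - 1)} : ℂ) = _
  unfold count
  congr 1
  have hb : ∀ T : SSYT lam, (∀ k, 1 ≤ k → T.wt k = d (k - 1)) → ∀ c, lam.cell c →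
      T.entry c ≤ N := by
    intro T hT c hc
    by_contra h
    have h1 := hT (T.entry c) (by omega)
    rw [hd _ (by omega)] at h1
    unfold SSYT.wt at h1
    rw [Set.ncard_eq_zero ((cells_finite lam).subset fun c hc => hc.1)] at h1
    have : c ∈ ({c' | lam.cell c' ∧ T.entry c' = T.entry c} : Set (ℕ × ℕ)) := ⟨hc, rfl⟩
    rw [h1] at this
    exact this
  refine Nat.card_congr
    { toFun := fun T => ⟨⟨fun c => T.1.entry c - 1, ?_, ?_, ?_⟩, ?_, ?_⟩
      invFun := fun T => ⟨⟨fun c => if lam.cell c then T.1.entry c + 1 else 0, ?_, ?_, ?_, ?_⟩, ?_⟩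
      left_inv := ?_
      right_inv := ?_ }
  · intro c hc
    simp [T.1.entry_outside c hc]
  · intro i j hc
    have := T.1.row_weak i j hc
    omega
  · intro i j hi hc
    have := T.1.col_strict i j hi hc
    have := T.1.entry_pos _ (cell_up hc hi)
    omega
  · intro c hc
    have := hb T.1 T.2 c hc
    have := T.1.entry_pos c hc
    simp only
    omega
  · intro k hk
    have h1 := T.2 (k + 1) (by omega)
    simp only [Nat.add_sub_cancel] at h1
    rw [← h1]
    unfold SympTab.cnt SSYT.wt
    congr 1
    ext c
    simp only [Set.mem_ofPred_eq]
    apply and_congr_right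
    intro hc
    have := T.1.entry_pos c hc
    omega
  · intro c hc
    simp [hc]
  · intro c hc
    simp [hc]
  · intro i j hc
    have := T.1.row_weak i j hc
    rw [if_pos hc]
    split_ifs <;> omega
  · intro i j hi hc
    have := T.1.col_strict i j hi hc
    rw [if_pos hc, if_pos (cell_up hc hi)]
    omega
  · intro k hk
    have h1 : T.1.cnt (k - 1) = d (k - 1) := by
      by_cases h : k - 1 < N
      · exact T.2.2 _ h
      · rw [hd _ (by omega)]
        unfold SympTab.cnt
        rw [Set.ncard_eq_zero ((cells_finite lam).subset fun c hc => hc.1)]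
        ext c
        simp only [Set.mem_ofPred_eq, Set.mem_empty_iff_false, iff_false]
        rintro ⟨h2, h3⟩
        have := T.2.1 c h2
        omega
    rw [← h1]
    unfold SympTab.cnt SSYT.wt
    congr 1
    ext c
    simp only [Set.mem_ofPred_eq]
    apply and_congr_right
    intro hc
    rw [if_pos hc]
    omega
  · rintro ⟨T, hT⟩
    apply Subtype.ext
    apply SSYT.ext'
    intro c hc
    have := T.entry_pos c hc
    simp only [if_pos hc]
    omega
  · rintro ⟨T, hT⟩
    apply Subtype.ext
    apply SympTab.ext'
    intro c hc
    simp [hc]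

lemma coeff_sSchur' (N : ℕ) (lam : Partn) (d : ℕ →₀ ℕ) (hd : ∀ k, N ≤ k → d k = 0) :
    MvPowerSeries.coeff d (sSchur lam) = MvPowerSeries.coeff d (SS N lam) := by
  rw [coeff_sSchur N lam d hd, coeff_SS, if_pos hd]

/-- the Pieri rule -/
lemma pieri (mu : Partn) (k : ℕ) :
    sSchur mu * sSchur (Partn.ofRow k) = ∑ lam ∈ above mu k, sSchur lam := by
  ext d
  obtain ⟨N, hN⟩ : ∃ N, ∀ k, N ≤ k → d k = 0 := by
    obtain ⟨M, hM⟩ := d.support.bddAbove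
    refine ⟨M + 1, fun k hk => ?_⟩
    by_contra h
    have : k ≤ M := hM (by simpa using h)
    omega
  have h := congrArg (MvPowerSeries.coeff d) (SS_pieri N mu k)
  rw [HH_eq, map_sum, MvPowerSeries.coeff_mul] at h
  rw [map_sum, Finset.sum_congr rfl (fun lam _ => coeff_sSchur' N lam d hN), ← h,
    MvPowerSeries.coeff_mul]
  apply Finset.sum_congr rfl
  rintro ⟨a, b⟩ hab
  rw [Finset.HasAntidiagonal.mem_antidiagonal] at hab
  have hab' : ∀ k, N ≤ k → a k = 0 ∧ b k = 0 := by
    intro k hk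
    have := hN k hk
    rw [← hab] at this
    simpa using this
  rw [coeff_sSchur' N _ a (fun k hk => (hab' k hk).1), coeff_sSchur' N _ b (fun k hk => (hab' k hk).2)]

lemma sSchur_empty : sSchur Partn.empty = 1 := by
  ext d
  obtain ⟨N, hN⟩ : ∃ N, ∀ k, N ≤ k → d k = 0 := by
    obtain ⟨M, hM⟩ := d.support.bddAbove
    refine ⟨M + 1, fun k hk => ?_⟩
    by_contra h
    have : k ≤ M := hM (by simpa using h)
    omega
  rw [coeff_sSchur' N _ d hN, SS_empty]

def FF (N n : ℕ) (Q : (ℕ → ℕ) → Prop) : MvPowerSeries ℕ ℂ :=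
  ∑ lam ∈ ofSize n, (count lam N Q : ℂ) • sSchur lam

lemma FF_zero (Q : (ℕ → ℕ) → Prop) (hQ : ∀ f, Q f) : FF 0 0 Q = 1 := by
  have : ofSize 0 = {Partn.empty} := by
    ext l
    rw [mem_ofSize, Finset.mem_singleton]
    exact ⟨size_eq_zero, fun h => h ▸ size_empty⟩
  simp [FF, this, count_empty Q hQ, sSchur_empty]

lemma FF_succ (N n k : ℕ) (Q : (ℕ → ℕ) → Prop)
    (hQ : ∀ f g : ℕ → ℕ, (∀ k < N, f k = g k) → (Q f ↔ Q g)) :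
    FF (N + 1) (n + k) (fun f => Q f ∧ f N = k) = FF N n Q * sSchur (Partn.ofRow k) := by
  unfold FF
  rw [Finset.sum_mul]
  simp only [smul_mul_assoc, pieri, Finset.smul_sum]
  have h1 : ∀ lam ∈ ofSize (n + k), (count lam (N + 1) (fun f => Q f ∧ f N = k) : ℂ) • sSchur lam
      = ∑ nu ∈ (below lam).filter (fun nu => nu.size = n), (count nu N Q : ℂ) • sSchur lam := by
    intro lam hl
    rw [mem_ofSize] at hl
    rw [count_rec lam N k Q hQ, ← Finset.sum_filter, Nat.cast_sum, Finset.sum_smul]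
    apply Finset.sum_congr _ (fun _ _ => rfl)
    ext nu
    simp only [Finset.mem_filter]
    apply and_congr_right
    intro _
    omega
  rw [Finset.sum_congr rfl h1]
  apply Finset.sum_comm'
  intro lam nu
  simp only [mem_ofSize, mem_above, Finset.mem_filter, mem_below]
  constructor
  · rintro ⟨h1, h2, h3⟩
    exact ⟨⟨h2, by omega⟩, h3⟩
  · rintro ⟨⟨h1, h2⟩, h3⟩
    exact ⟨by omega, h1, h3⟩

def QQ (m : ℕ → ℕ) (ell : ℕ) (f : ℕ → ℕ) : Prop :=
  f 0 = m 0 ∧ ∀ k, 1 ≤ k → k ≤ ell → f (2 * k - 1) + f (2 * k) = m k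

lemma QQ_local (m : ℕ → ℕ) (ell : ℕ) (f g : ℕ → ℕ) (h : ∀ k < 2 * ell + 1, f k = g k) :
    QQ m ell f ↔ QQ m ell g := by
  unfold QQ
  rw [h 0 (by omega)]
  apply and_congr_right
  intro _
  apply forall_congr'; intro k
  apply forall_congr'; intro h1
  apply forall_congr'; intro h2
  rw [h _ (by omega), h _ (by omega)]

lemma FF_main (m : ℕ → ℕ) (ell : ℕ) :
    FF (2 * ell + 1) (∑ r ∈ Finset.range (ell + 1), m r) (QQ m ell) =
    sSchur (Partn.ofRow (m 0)) *
        ∏ r ∈ Finset.Icc 1 ell, ∑ i ∈ Finset.range (m r + 1),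
          sSchur (Partn.ofRow i) * sSchur (Partn.ofRow (m r - i)) := by
  induction ell with
  | zero =>
    have h := FF_succ 0 0 (m 0) (fun _ => True) (by simp)
    rw [FF_zero _ (by simp), one_mul] at h
    simp only [zero_add, true_and] at h
    simp only [mul_zero, zero_add, Finset.range_one, Finset.sum_singleton]
    rw [Finset.Icc_eq_empty (by omega), Finset.prod_empty, mul_one, ← h]
    congr 1
    funext f
    apply propext
    unfold QQ
    constructor
    · exact fun h => h.1
    · exact fun h => ⟨h, fun k h1 h2 => by omega⟩
  | succ ell ih =>
    rw [Finset.prod_Icc_succ_top (by omega), ← mul_assoc, ← ih, Finset.mul_sum]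
    set n := ∑ r ∈ Finset.range (ell + 1), m r with hn
    rw [Finset.sum_range_succ, ← hn]
    have h1 : ∀ i ∈ Finset.range (m (ell + 1) + 1), FF (2 * ell + 1) n (QQ m ell) *
        (sSchur (Partn.ofRow i) * sSchur (Partn.ofRow (m (ell + 1) - i))) =
        FF (2 * (ell + 1) + 1) (n + m (ell + 1)) (fun f => (QQ m ell f ∧ f (2 * ell + 1) = i) ∧
          f (2 * ell + 1 + 1) = m (ell + 1) - i) := by
      intro i hi
      rw [Finset.mem_range] at hi
      rw [← mul_assoc, ← FF_succ _ _ _ _ (QQ_local m ell), ← FF_succ]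
      · congr 1
        omega
      · intro f g h
        rw [QQ_local m ell f g (fun k hk => h k (by omega)), h _ (by omega)]
    rw [Finset.sum_congr rfl h1]
    unfold FF
    rw [Finset.sum_comm]
    apply Finset.sum_congr rfl
    intro lam _
    rw [← Finset.sum_smul, ← Nat.cast_sum]
    congr 2
    unfold count
    rw [card_split _ (Finset.range (m (ell + 1) + 1)) (fun T i => T.cnt (2 * ell + 1) = i)]
    · apply Finset.sum_congr rfl
      intro i hi
      rw [Finset.mem_range] at hi
      refine Nat.card_congr (Equiv.subtypeEquivRight ?_)
      intro T
      unfold QQ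
      constructor
      · rintro ⟨⟨h1, h2, h3⟩, h4⟩
        refine ⟨h1, ⟨⟨h2, fun k hk hk' => h3 k hk (by omega)⟩, h4⟩, ?_⟩
        have := h3 (ell + 1) (by omega) le_rfl
        rw [show 2 * (ell + 1) - 1 = 2 * ell + 1 by omega, h4] at this
        rw [show 2 * (ell + 1) = 2 * ell + 1 + 1 by omega] at this
        omega
      · rintro ⟨h1, ⟨⟨h2, h3⟩, h4⟩, h5⟩
        refine ⟨⟨h1, h2, fun k hk hk' => ?_⟩, h4⟩
        rcases Nat.eq_or_lt_of_le hk' with rfl | hk'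
        · rw [show 2 * (ell + 1) - 1 = 2 * ell + 1 by omega, h4,
            show 2 * (ell + 1) = 2 * ell + 1 + 1 by omega, h5]
          omega
        · exact h3 k hk (by omega)
    · rintro T ⟨h1, h2, h3⟩
      refine ⟨_, ?_, rfl⟩
      have := h3 (ell + 1) (by omega) le_rfl
      rw [show 2 * (ell + 1) - 1 = 2 * ell + 1 by omega] at this
      rw [Finset.mem_range]
      omega
    · rintro T b b' _ rfl rfl
      rfl

lemma wt_eq {lam : Partn} (T : SympTab lam) (k : ℕ) (hk : 1 ≤ k) :
    T.wt k = T.cnt (2 * k - 1) + T.cnt (2 * k) := by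
  have hf : ∀ j, {c : ℕ × ℕ | lam.cell c ∧ T.entry c = j}.Finite := fun j =>
    (cells_finite lam).subset fun c hc => hc.1
  unfold SympTab.wt SympTab.cnt
  rw [if_neg (by omega), ← Set.ncard_union_eq ?_ (hf _) (hf _)]
  · congr 1
    ext c
    simp only [Set.mem_ofPred_eq, Set.mem_union]
    tauto
  · rw [Set.disjoint_left]
    intro c h1 h2
    have h3 := h1.2
    have h4 := h2.2
    omega

lemma count_symp (lam : Partn) (m : ℕ → ℕ) (ell : ℕ) :
    Nat.card {T : SympTab lam // T.wt 0 = m 0 ∧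
          ∀ k, 1 ≤ k → T.wt k = if k ≤ ell then m k else 0} =
    count lam (2 * ell + 1) (QQ m ell) := by
  unfold count
  refine Nat.card_congr (Equiv.subtypeEquivRight ?_)
  intro T
  have h0 : T.wt 0 = T.cnt 0 := by simp [SympTab.wt, SympTab.cnt]
  have hz : ∀ k, T.cnt k = 0 ↔ ∀ c, lam.cell c → T.entry c ≠ k := by
    intro k
    unfold SympTab.cnt
    rw [Set.ncard_eq_zero ((cells_finite lam).subset fun c hc => hc.1), Set.eq_empty_iff_forall_notMem]
    simp
  rw [h0]
  unfold QQ
  constructor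
  · rintro ⟨h1, h2⟩
    refine ⟨?_, h1, ?_⟩
    · intro c hc
      by_contra h
      have h3 := h2 ((T.entry c + 1) / 2) (by omega)
      rw [if_neg (by omega), wt_eq _ _ (by omega), Nat.add_eq_zero_iff, hz, hz] at h3
      have h4 := h3.1 c hc
      have h5 := h3.2 c hc
      omega
    · intro k hk hk'
      rw [← wt_eq T k hk, h2 k hk, if_pos hk']
  · rintro ⟨h1, h2, h3⟩
    refine ⟨h2, fun k hk => ?_⟩
    rw [wt_eq T k hk]
    split_ifs with h
    · exact h3 k hk h
    · rw [Nat.add_eq_zero_iff, hz, hz]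
      constructor
      · intro c hc
        have := h1 c hc
        omega
      · intro c hc
        have := h1 c hc
        omega

/-- Lemma `PieriLemma` (a).  For nonnegative integers
`(m_0, m_1, …, m_ℓ)` summing to `n`,
`s_{(m_0)} ∏_{r=1}^ℓ ∑_{i=0}^{m_r} s_{(i)} s_{(m_r - i)} = ∑_{λ ⊢ n} |T^λ| s_λ`,
where `|T^λ|` is the number of symplectic tableaux of shape `λ/(m_0)` and weight
`(m_0, m_1, …, m_ℓ)`. -/
theorem pieri_symplectic (ell : ℕ) (m : ℕ → ℕ) (n : ℕ)
    (hsum : ∑ r ∈ Finset.range (ell + 1), m r = n) :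
    sSchur (Partn.ofRow (m 0)) *
        ∏ r ∈ Finset.Icc 1 ell, ∑ i ∈ Finset.range (m r + 1),
          sSchur (Partn.ofRow i) * sSchur (Partn.ofRow (m r - i)) =
      ∑ᶠ lam : Partn, if lam.size = n then
        (Nat.card {T : SympTab lam // T.wt 0 = m 0 ∧
          ∀ k, 1 ≤ k → T.wt k = if k ≤ ell then m k else 0} : ℂ) • sSchur lam
      else 0 := by
  subst hsum
  rw [← FF_main, finsum_eq_sum_of_support_subset
    (s := ofSize (∑ r ∈ Finset.range (ell + 1), m r))]
  · unfold FF
    apply Finset.sum_congr rfl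
    intro lam hl
    rw [mem_ofSize] at hl
    rw [if_pos hl, count_symp]
  · intro lam hl
    rw [Function.mem_support] at hl
    rw [Finset.mem_coe, mem_ofSize]
    by_contra h
    rw [if_neg h] at hl
    exact hl rfl

end GGU
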